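/- Let q ≥ 1 and n ∈ ℕ₀, and let (s_j)_{j=0}^{2n} ∈ H≥,e_{q,2n}. Then D_n is a Dubovoj subspace corresponding to (H_n, T_{q,n}), i.e., T_{q,n}*(D_n) ⊆ D_n, ker H_n ∩ D_n = {0}, and ker H_n + D_n = ℂ^{(n+1)q}. Moreover dim D_n = rank H_n and dim D_n = Σ_{j=0}^{n} rank L_j. -/

import Mathlib

open Matrix ComplexConjugate
open scoped ComplexOrder

noncomputable section

/-- The block Hankel matrix `H_n = [s_{j+k}]_{j,k=0}^n`. -/
def hank (q n : ℕ) (s : ℕ → Matrix (Fin q) (Fin q) ℂ) :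
    Matrix (Fin (n + 1) × Fin q) (Fin (n + 1) × Fin q) ℂ :=
  Matrix.of fun j k => s (j.1.val + k.1.val) j.2 k.2

/-- The right-sided `α`-shifted sequence `s_{α▷j} = -α·s_j + s_{j+1}`. -/
def sShift {q : ℕ} (α : ℝ) (s : ℕ → Matrix (Fin q) (Fin q) ℂ) :
    ℕ → Matrix (Fin q) (Fin q) ℂ :=
  fun j => (-(α : ℂ)) • s j + s (j + 1)

/-- The block shift `T_{q,n} = [δ_{j,k+1}·I_q]_{j,k=0}^n`. -/
def bshift (q n : ℕ) : Matrix (Fin (n + 1) × Fin q) (Fin (n + 1) × Fin q) ℂ :=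
  Matrix.of fun j k => if j.1.val = k.1.val + 1 ∧ j.2 = k.2 then (1 : ℂ) else 0

/-- `v_{q,n} = col(δ_{j,0}·I_q)_{j=0}^n`. -/
def vq (q n : ℕ) : Matrix (Fin (n + 1) × Fin q) (Fin q) ℂ :=
  Matrix.of fun j b => if j.1.val = 0 ∧ j.2 = b then (1 : ℂ) else 0

/-- `u_n = -col(s_{j-1})_{j=0}^n` with `s_{-1} = 0`. -/
def uq (q n : ℕ) (s : ℕ → Matrix (Fin q) (Fin q) ℂ) :
    Matrix (Fin (n + 1) × Fin q) (Fin q) ℂ :=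
  Matrix.of fun j b => if j.1.val = 0 then 0 else -s (j.1.val - 1) j.2 b

/-- `y_{0,n} = col(s_j)_{j=0}^n`. -/
def yq (q n : ℕ) (s : ℕ → Matrix (Fin q) (Fin q) ℂ) :
    Matrix (Fin (n + 1) × Fin q) (Fin q) ℂ :=
  Matrix.of fun j b => s j.1.val j.2 b

/-- `R_T(z) = (I - z·T_{q,n})⁻¹`. -/
def RT (q n : ℕ) (z : ℂ) : Matrix (Fin (n + 1) × Fin q) (Fin (n + 1) × Fin q) ℂ :=
  (1 - z • bshift q n)⁻¹

/-- `R_{T*}(z) = (I - z·T_{q,n}*)⁻¹`. -/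
def RTs (q n : ℕ) (z : ℂ) : Matrix (Fin (n + 1) × Fin q) (Fin (n + 1) × Fin q) ℂ :=
  (1 - z • (bshift q n)ᴴ)⁻¹

open scoped Classical in
/-- The Moore–Penrose inverse of a complex matrix (it exists and is unique,
so the `dite` below always takes its first branch and picks it out). -/
def mp {m n : Type*} [Fintype m] [Fintype n] (A : Matrix m n ℂ) : Matrix n m ℂ :=
  if h : ∃ X : Matrix n m ℂ,
      A * X * A = A ∧ X * A * X = X ∧ (A * X)ᴴ = A * X ∧ (X * A)ᴴ = X * A
  then h.choose else 0

/-- The Schur complements `L_0 = s_0` and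
`L_j = s_{2j} - z_{j,2j-1}·(H_{j-1})^†·y_{j,2j-1}` for `j ≥ 1`. -/
def LS (q : ℕ) (s : ℕ → Matrix (Fin q) (Fin q) ℂ) : ℕ → Matrix (Fin q) (Fin q) ℂ
  | 0 => s 0
  | n + 1 =>
      s (2 * (n + 1)) -
        (Matrix.of fun (a : Fin q) (j : Fin (n + 1) × Fin q) => s ((n + 1) + j.1.val) a j.2) *
          mp (hank q n s) *
          (Matrix.of fun (j : Fin (n + 1) × Fin q) (b : Fin q) => s ((n + 1) + j.1.val) j.2 b)

/-- The block diagonal matrix `diag(L_0, …, L_n)`. -/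
def Ldiag (q n : ℕ) (s : ℕ → Matrix (Fin q) (Fin q) ℂ) :
    Matrix (Fin (n + 1) × Fin q) (Fin (n + 1) × Fin q) ℂ :=
  Matrix.of fun j k => if j.1 = k.1 then LS q s j.1.val j.2 k.2 else 0

/-- The subspace `D_n = range(diag(L_0, …, L_n)) ⊆ ℂ^{(n+1)q}`. -/
def Dsub (q n : ℕ) (s : ℕ → Matrix (Fin q) (Fin q) ℂ) :
    Submodule ℂ (Fin (n + 1) × Fin q → ℂ) :=
  LinearMap.range (Matrix.mulVecLin (Ldiag q n s))

/-- `V_{q,n+1} = [δ_{j,k}·I_q]`, embedding `ℂ^{(n+1)q}` into the first `n+1` block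
components of `ℂ^{(n+2)q}` (defined here with `n+1` block columns). -/
def embV (q n : ℕ) : Matrix (Fin (n + 1) × Fin q) (Fin n × Fin q) ℂ :=
  Matrix.of fun j k => if j.1.val = k.1.val ∧ j.2 = k.2 then (1 : ℂ) else 0

/-- `𝔙_{q,n+1} = [δ_{j,k+1}·I_q]`, embedding `ℂ^{(n+1)q}` into the last `n+1` block
components of `ℂ^{(n+2)q}` (defined here with `n+1` block columns). -/
def embW (q n : ℕ) : Matrix (Fin (n + 1) × Fin q) (Fin n × Fin q) ℂ :=
  Matrix.of fun j k => if j.1.val = k.1.val + 1 ∧ j.2 = k.2 then (1 : ℂ) else 0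

end

theorem exists_mp {m : Type*} [Fintype m] [DecidableEq m] (A : Matrix m m ℂ)
    (hA : A.IsHermitian) : ∃ X : Matrix m m ℂ,
      A * X * A = A ∧ X * A * X = X ∧ (A * X)ᴴ = A * X ∧ (X * A)ᴴ = X * A ∧ A * X = X * A := by
  obtain ⟨U, V, d, hVU, hV, hd, hAe⟩ : ∃ (U V : Matrix m m ℂ) (d : m → ℂ), V * U = 1 ∧ V = Uᴴ ∧
      (∀ i, star (d i) = d i) ∧ A = U * diagonal d * V := by
    refine ⟨hA.eigenvectorUnitary, star (hA.eigenvectorUnitary : Matrix m m ℂ),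
      RCLike.ofReal ∘ hA.eigenvalues, by simp, rfl, by simp, ?_⟩
    conv_lhs => rw [hA.spectral_theorem]
    simp [Unitary.conjStarAlgAut_apply]
  have key : ∀ e f : m → ℂ, (U * diagonal e * V) * (U * diagonal f * V)
      = U * diagonal (fun i => e i * f i) * V := by
    intro e f
    calc _ = U * diagonal e * (V * U) * diagonal f * V := by simp only [Matrix.mul_assoc]
      _ = U * (diagonal e * diagonal f) * V := by rw [hVU]; simp only [Matrix.mul_assoc, Matrix.one_mul]
      _ = _ := by rw [diagonal_mul_diagonal]
  have keyH : ∀ e : m → ℂ, (∀ i, star (e i) = e i) → (U * diagonal e * V)ᴴ = U * diagonal e * V := by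
    intro e he
    have : star e = e := funext he
    rw [hV]
    simp [Matrix.conjTranspose_mul, diagonal_conjTranspose, this, Matrix.mul_assoc]
  refine ⟨U * diagonal (fun i => (d i)⁻¹) * V, ?_, ?_, ?_, ?_, ?_⟩ <;> rw [hAe]
  · rw [key, key]
    congr 3; ext i
    by_cases h : d i = 0 <;> simp [h]
  · rw [key, key]
    congr 3; ext i
    by_cases h : d i = 0 <;> simp [h]
  · rw [key]; apply keyH; intro i
    rw [star_mul', star_inv₀, hd]
  · rw [key]; apply keyH; intro i
    rw [star_mul', star_inv₀, hd]
  · rw [key, key]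
    congr 3; ext i; rw [mul_comm]

theorem mp_spec {m : Type*} [Fintype m] [DecidableEq m] (A : Matrix m m ℂ)
    (hA : A.IsHermitian) : A * mp A * A = A := by
  have h : ∃ X : Matrix m m ℂ,
      A * X * A = A ∧ X * A * X = X ∧ (A * X)ᴴ = A * X ∧ (X * A)ᴴ = X * A := by
    obtain ⟨X, h1, h2, h3, h4, _⟩ := exists_mp A hA
    exact ⟨X, h1, h2, h3, h4⟩
  unfold mp
  rw [dif_pos h]
  exact h.choose_spec.1

theorem factor {m p : Type*} [Fintype m] [DecidableEq m] [Fintype p] (H : Matrix m m ℂ)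
    (hH : H.IsHermitian) (z : Matrix p m ℂ) (hz : ∀ x, H *ᵥ x = 0 → z *ᵥ x = 0) :
    ∃ K : Matrix m p ℂ, H * K = zᴴ := by
  obtain ⟨X, h1, -⟩ := exists_mp H hH
  have e : z * (1 - X * H) = 0 := by
    apply Matrix.ext_of_mulVec_single
    intro i
    rw [← Matrix.mulVec_mulVec, Matrix.zero_mulVec]
    apply hz
    rw [Matrix.mulVec_mulVec, Matrix.mul_sub, ← Matrix.mul_assoc, h1, Matrix.mul_one, sub_self,
      Matrix.zero_mulVec]
  refine ⟨Xᴴ * zᴴ, ?_⟩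
  have e2 : z = z * (X * H) := by
    rw [Matrix.mul_sub, Matrix.mul_one, sub_eq_zero] at e
    exact e
  conv_rhs => rw [e2]
  simp [Matrix.conjTranspose_mul, hH.eq, Matrix.mul_assoc]

theorem range_mono {q : ℕ} (L M : Matrix (Fin q) (Fin q) ℂ) (hL : L.IsHermitian)
    (hM : M.IsHermitian) (h : ∀ x, L *ᵥ x = 0 → M *ᵥ x = 0) (u : Fin q → ℂ) :
    ∃ w, M *ᵥ u = L *ᵥ w := by
  obtain ⟨K, hK⟩ := factor L hL M h
  rw [hM.eq] at hK
  exact ⟨K *ᵥ u, by rw [Matrix.mulVec_mulVec, hK]⟩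

theorem range_sq {q : ℕ} (L : Matrix (Fin q) (Fin q) ℂ) (hL : L.IsHermitian) (u : Fin q → ℂ) :
    ∃ w, L *ᵥ (L *ᵥ w) = L *ᵥ u := by
  obtain ⟨X, h1, h2, h3, h4, h5⟩ := exists_mp L hL
  refine ⟨X *ᵥ u, ?_⟩
  rw [Matrix.mulVec_mulVec, Matrix.mulVec_mulVec, Matrix.mul_assoc, h5, ← Matrix.mul_assoc, h1]

theorem sq_zero {q : ℕ} (L : Matrix (Fin q) (Fin q) ℂ) (hL : L.IsHermitian) (u : Fin q → ℂ)
    (h : L *ᵥ (L *ᵥ u) = 0) : L *ᵥ u = 0 := by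
  rw [← Matrix.conjTranspose_mul_self_mulVec_eq_zero, hL.eq, ← Matrix.mulVec_mulVec, h]

/-- action of the first `m+1` block columns on a sequence of vectors, row `a`. -/
noncomputable def act {q : ℕ} (t : ℕ → Matrix (Fin q) (Fin q) ℂ) (m : ℕ) (x : ℕ → Fin q → ℂ)
    (a : ℕ) : Fin q → ℂ := ∑ b ∈ Finset.range (m + 1), t (a + b) *ᵥ x b

theorem blk_mulVec {q m : ℕ} (g : ℕ → Matrix (Fin q) (Fin q) ℂ) (x : Fin (m + 1) × Fin q → ℂ)
    (y : ℕ → Fin q → ℂ) (hy : ∀ j, y (Fin.val j.1) j.2 = x j) (i : Fin q) :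
    ∑ p : Fin (m + 1) × Fin q, g p.1.val i p.2 * x p
      = (∑ b ∈ Finset.range (m + 1), g b *ᵥ y b) i := by
  rw [Finset.sum_apply, Finset.sum_range, Fintype.sum_prod_type]
  refine Finset.sum_congr rfl fun b _ => ?_
  simp only [Matrix.mulVec, dotProduct]
  refine Finset.sum_congr rfl fun k _ => ?_
  rw [← hy]

theorem hank_mulVec {q m : ℕ} (t : ℕ → Matrix (Fin q) (Fin q) ℂ) (x : Fin (m + 1) × Fin q → ℂ)
    (y : ℕ → Fin q → ℂ) (hy : ∀ j, y (Fin.val j.1) j.2 = x j) (p : Fin (m + 1) × Fin q) :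
    (hank q m t *ᵥ x) p = act t m y p.1.val p.2 :=
  blk_mulVec (fun b => t (p.1.val + b)) x y hy p.2

theorem hank_ker {q m : ℕ} (t : ℕ → Matrix (Fin q) (Fin q) ℂ) (x : Fin (m + 1) × Fin q → ℂ)
    (y : ℕ → Fin q → ℂ) (hy : ∀ j, y (Fin.val j.1) j.2 = x j) :
    hank q m t *ᵥ x = 0 ↔ ∀ a ≤ m, act t m y a = 0 := by
  constructor
  · intro h a ha
    ext i
    have := congrFun h (⟨a, by omega⟩, i)
    rwa [hank_mulVec t x y hy] at this
  · intro h
    ext p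
    rw [hank_mulVec t x y hy, h _ (by have := p.1.2; omega)]
    rfl

/-- extend a block vector by zero. -/
noncomputable def ex {q m : ℕ} (x : Fin (m + 1) × Fin q → ℂ) : ℕ → Fin q → ℂ :=
  fun j i => if h : j < m + 1 then x (⟨j, h⟩, i) else 0

theorem ex_spec {q m : ℕ} (x : Fin (m + 1) × Fin q → ℂ) (j : Fin (m + 1) × Fin q) :
    ex x (Fin.val j.1) j.2 = x j := by
  unfold ex
  rw [dif_pos j.1.2]

theorem act_congr {q : ℕ} (t : ℕ → Matrix (Fin q) (Fin q) ℂ) (m : ℕ) (x y : ℕ → Fin q → ℂ)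
    (h : ∀ b ≤ m, x b = y b) (a : ℕ) : act t m x a = act t m y a := by
  refine Finset.sum_congr rfl fun b hb => ?_
  rw [h b (by simp at hb; omega)]

theorem act_pad {q : ℕ} (t : ℕ → Matrix (Fin q) (Fin q) ℂ) (m M : ℕ) (hm : m ≤ M)
    (y : ℕ → Fin q → ℂ) (h : ∀ b, m < b → y b = 0) (a : ℕ) : act t M y a = act t m y a := by
  symm
  apply Finset.sum_subset
  · intro b; simp; omega
  · intro b _ hb
    rw [h b (by simp at hb; omega), Matrix.mulVec_zero]

section
variable {q N : ℕ} {t : ℕ → Matrix (Fin q) (Fin q) ℂ}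

theorem pad (hP : (hank q N t).PosSemidef) (m : ℕ) (hm : m ≤ N) (x : ℕ → Fin q → ℂ)
    (hx : ∀ a ≤ m, act t m x a = 0) (a : ℕ) (ha : a ≤ N) : act t m x a = 0 := by
  classical
  set y : ℕ → Fin q → ℂ := fun b => if b ≤ m then x b else 0 with hy
  have e : ∀ a, act t N y a = act t m x a := by
    intro a
    rw [act_pad t m N hm y (fun b hb => by simp [hy, hb])]
    exact act_congr _ _ _ _ (fun b hb => by simp [hy, hb]) _
  have hk : hank q N t *ᵥ (fun p => y p.1.val p.2) = 0 := by
    rw [← hP.dotProduct_mulVec_zero_iff]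
    refine Finset.sum_eq_zero fun p _ => ?_
    rw [hank_mulVec t _ y (fun _ => rfl), e]
    by_cases hp : p.1.val ≤ m
    · rw [hx _ hp]; simp
    · simp [hy, hp]
  rw [hank_ker t _ y (fun _ => rfl)] at hk
  rw [← e]; exact hk a ha

theorem t_herm (hP : (hank q N t).PosSemidef) (j : ℕ) (hj : j ≤ 2 * N) : (t j).IsHermitian := by
  ext i k
  have := congrFun (congrFun hP.isHermitian (⟨j / 2, by omega⟩, i)) (⟨j - j / 2, by omega⟩, k)
  simp only [Matrix.conjTranspose_apply, hank, Matrix.of_apply] at this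
  rw [show j - j / 2 + j / 2 = j by omega, show j / 2 + (j - j / 2) = j by omega] at this
  exact this

theorem hank_herm (hP : (hank q N t).PosSemidef) (m : ℕ) (hm : m ≤ N) :
    (hank q m t).IsHermitian := by
  ext i k
  have h1 := i.1.2
  have h2 := k.1.2
  have := congrFun (congrFun (t_herm hP (i.1.val + k.1.val) (by omega)) i.2) k.2
  simp only [Matrix.conjTranspose_apply, hank, Matrix.of_apply] at this ⊢
  rw [add_comm k.1.val]; exact this

theorem LS_facts (hP : (hank q N t).PosSemidef) (j : ℕ) (hj : j ≤ N) :
    (LS q t j).IsHermitian ∧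
    (∀ v, ∃ x : ℕ → Fin q → ℂ, x j = v ∧ ∀ a < j, act t j x a = 0) ∧
    (∀ x : ℕ → Fin q → ℂ, (∀ a < j, act t j x a = 0) → act t j x j = LS q t j *ᵥ x j) := by
  cases j with
  | zero =>
    refine ⟨t_herm hP 0 (by omega), fun v => ⟨fun _ => v, rfl, by simp⟩, fun x _ => ?_⟩
    simp [act, LS]
  | succ n =>
    set z := (Matrix.of fun (a : Fin q) (j : Fin (n + 1) × Fin q) => t ((n + 1) + j.1.val) a j.2)
      with hz
    have hy : (Matrix.of fun (j : Fin (n + 1) × Fin q) (b : Fin q) =>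
        t ((n + 1) + j.1.val) j.2 b) = zᴴ := by
      ext p b
      have h1 := p.1.2
      have := congrFun (congrFun (t_herm hP (n + 1 + p.1.val) (by omega)) p.2) b
      simp only [hz, Matrix.conjTranspose_apply, Matrix.of_apply] at this ⊢
      exact this.symm
    have hH := hank_herm hP n (by omega)
    have hzx : ∀ (x : Fin (n + 1) × Fin q → ℂ) (y : ℕ → Fin q → ℂ),
        (∀ j, y (Fin.val j.1) j.2 = x j) → z *ᵥ x = act t n y (n + 1) := by
      intro x y hxy
      ext i
      exact blk_mulVec (fun b => t (n + 1 + b)) x y hxy i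
    obtain ⟨K, hK⟩ := factor (hank q n t) hH z (by
      intro x hx
      rw [hzx x (ex x) (ex_spec x)]
      rw [hank_ker t x (ex x) (ex_spec x)] at hx
      exact pad hP n (by omega) _ hx _ hj)
    have hKz : z = Kᴴ * hank q n t := by
      have := congrArg Matrix.conjTranspose hK
      rw [Matrix.conjTranspose_mul, hH.eq, Matrix.conjTranspose_conjTranspose] at this
      exact this.symm
    have hL : LS q t (n + 1) = t (2 * (n + 1)) - Kᴴ * hank q n t * K := by
      have : LS q t (n + 1) = t (2 * (n + 1)) - z * mp (hank q n t) * zᴴ := by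
        rw [← hy]; rfl
      rw [this, ← hK, hKz]
      congr 1
      calc _ = Kᴴ * (hank q n t * mp (hank q n t) * hank q n t) * K := by
            simp only [Matrix.mul_assoc]
        _ = _ := by rw [mp_spec _ hH]
    have hsplit : ∀ (x : ℕ → Fin q → ℂ) a,
        act t (n + 1) x a = act t n x a + t (a + (n + 1)) *ᵥ x (n + 1) := by
      intro x a
      exact Finset.sum_range_succ _ _
    have hrow : ∀ (x : ℕ → Fin q → ℂ), (∀ a < n + 1, act t (n + 1) x a = 0) ↔
        hank q n t *ᵥ (fun p => x p.1.val p.2) + zᴴ *ᵥ x (n + 1) = 0 := by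
      intro x
      have hc : ∀ p : Fin (n + 1) × Fin q, (hank q n t *ᵥ (fun p => x p.1.val p.2)
          + zᴴ *ᵥ x (n + 1)) p = act t (n + 1) x p.1.val p.2 := by
        intro p
        rw [hsplit, Pi.add_apply, Pi.add_apply, hank_mulVec t _ x (fun _ => rfl), ← hy, add_comm p.1.val]
        rfl
      constructor
      · intro h
        ext p
        rw [hc, h _ p.1.2]; rfl
      · intro h a ha
        ext i
        have := congrFun h (⟨a, ha⟩, i)
        rw [hc] at this
        exact this
    refine ⟨?_, ?_, ?_⟩
    · rw [hL]
      refine (t_herm hP _ (by omega)).sub ?_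
      unfold Matrix.IsHermitian
      simp [Matrix.conjTranspose_mul, hH.eq, Matrix.mul_assoc]
    · intro v
      refine ⟨fun b => if b = n + 1 then v else ex (-(K *ᵥ v)) b, by simp, ?_⟩
      rw [hrow]
      have : (fun p : Fin (n + 1) × Fin q =>
          (if p.1.val = n + 1 then v else ex (-(K *ᵥ v)) p.1.val) p.2) = -(K *ᵥ v) := by
        ext p
        rw [if_neg (by have := p.1.2; omega), ex_spec]
      rw [this]
      simp [Matrix.mulVec_neg, Matrix.mulVec_mulVec, hK]
    · intro x hx
      rw [hrow] at hx
      rw [hsplit, ← hzx (fun p => x p.1.val p.2) x (fun _ => rfl), hL, Matrix.sub_mulVec]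
      have h2 := congrArg (fun w => Kᴴ *ᵥ w) hx
      simp only [Matrix.mulVec_add, Matrix.mulVec_mulVec, ← hKz, Matrix.mulVec_zero] at h2
      rw [← hK, ← Matrix.mul_assoc] at h2
      rw [eq_neg_of_add_eq_zero_left h2, two_mul]
      abel

theorem LS_ker (hP : (hank q N t).PosSemidef) (j : ℕ) (hj : j + 2 ≤ N) (v : Fin q → ℂ)
    (hv : LS q t j *ᵥ v = 0) : LS q t (j + 1) *ᵥ v = 0 := by
  obtain ⟨-, h2, h3⟩ := LS_facts hP j (by omega)
  obtain ⟨x, rfl, hx⟩ := h2 v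
  have h0 := h3 x hx
  rw [hv] at h0
  have hall := pad hP j (by omega) x (fun a ha => by
    rcases Nat.lt_or_eq_of_le ha with h | rfl
    · exact hx a h
    · exact h0)
  set y : ℕ → Fin q → ℂ := fun b => if b = 0 then 0 else x (b - 1) with hy
  have e : ∀ a, act t (j + 1) y a = act t j x (a + 1) := by
    intro a
    unfold act
    rw [Finset.sum_range_succ']
    simp only [hy, if_true, Matrix.mulVec_zero, add_zero]
    refine Finset.sum_congr rfl fun b _ => ?_
    simp only [Nat.succ_ne_zero, if_false, Nat.add_sub_cancel]
    rw [add_assoc a 1 b, add_comm 1 b]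
  have := (LS_facts hP (j + 1) (by omega)).2.2 y (fun a ha => by rw [e]; exact hall _ (by omega))
  rw [e, hall _ (by omega)] at this
  simpa [hy] using this.symm

theorem inter (hP : (hank q N t).PosSemidef) (m : ℕ) (hm : m ≤ N) (x : ℕ → Fin q → ℂ)
    (hk : ∀ a ≤ m, act t m x a = 0) (hD : ∀ b ≤ m, ∃ u, x b = LS q t b *ᵥ u) :
    ∀ b ≤ m, x b = 0 := by
  have top : x m = 0 := by
    obtain ⟨h1, -, h3⟩ := LS_facts hP m hm
    have := h3 x (fun a ha => hk a ha.le)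
    rw [hk m le_rfl] at this
    obtain ⟨u, hu⟩ := hD m le_rfl
    rw [hu] at this ⊢
    exact sq_zero _ h1 u this.symm
  induction m with
  | zero => intro b hb; obtain rfl : b = 0 := by omega
            exact top
  | succ m ih =>
    have hk' : ∀ a ≤ m, act t m x a = 0 := by
      intro a ha
      have h := hk a (by omega)
      have e : act t (m + 1) x a = act t m x a + t (a + (m + 1)) *ᵥ x (m + 1) :=
        Finset.sum_range_succ _ _
      rw [e, top, Matrix.mulVec_zero, add_zero] at h
      exact h
    have topm : x m = 0 := by
      obtain ⟨h1, -, h3⟩ := LS_facts hP m (by omega)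
      have := h3 x (fun a ha => hk' a ha.le)
      rw [hk' m le_rfl] at this
      obtain ⟨u, hu⟩ := hD m (by omega)
      rw [hu] at this ⊢
      exact sq_zero _ h1 u this.symm
    intro b hb
    rcases Nat.lt_or_eq_of_le hb with h | rfl
    · exact ih (by omega) hk' (fun b hb => hD b (by omega)) topm b (by omega)
    · exact top

theorem act_add (m : ℕ) (x y : ℕ → Fin q → ℂ) (a : ℕ) :
    act t m (x + y) a = act t m x a + act t m y a := by
  simp [act, Matrix.mulVec_add, Finset.sum_add_distrib]

theorem span (hP : (hank q N t).PosSemidef) (m : ℕ) (hm : m ≤ N) (x : ℕ → Fin q → ℂ) :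
    ∃ k d : ℕ → Fin q → ℂ, (∀ b ≤ m, x b = k b + d b) ∧ (∀ a ≤ m, act t m k a = 0) ∧
      ∀ b ≤ m, ∃ u, d b = LS q t b *ᵥ u := by
  -- one elimination step
  have step : ∀ m ≤ N, ∀ x : ℕ → Fin q → ℂ, ∃ w : ℕ → Fin q → ℂ, (∀ a ≤ m, act t m w a = 0) ∧
      ∃ u, x m - w m = LS q t m *ᵥ u := by
    intro m hm x
    obtain ⟨h1, h2, h3⟩ := LS_facts hP m hm
    obtain ⟨u, hu⟩ := range_sq _ h1 (x m)
    obtain ⟨w, hw, hw0⟩ := h2 (x m - LS q t m *ᵥ u)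
    refine ⟨w, fun a ha => ?_, u, by rw [hw]; abel⟩
    rcases Nat.lt_or_eq_of_le ha with h | rfl
    · exact hw0 a h
    · rw [h3 w hw0, hw, Matrix.mulVec_sub, hu, sub_self]
  induction m generalizing x with
  | zero =>
    obtain ⟨w, hw, u, hu⟩ := step 0 hm x
    refine ⟨w, x - w, by simp, hw, fun b hb => ?_⟩
    obtain rfl : b = 0 := by omega
    exact ⟨u, hu⟩
  | succ m ih =>
    obtain ⟨w, hw, u, hu⟩ := step (m + 1) hm x
    obtain ⟨k, d, h1, h2, h3⟩ := ih (by omega) (x - w)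
    set k' : ℕ → Fin q → ℂ := fun b => if b ≤ m then k b else 0 with hk'
    refine ⟨w + k', x - w - k', fun b _ => by simp, fun a ha => ?_, fun b hb => ?_⟩
    · rw [act_add, hw a ha, act_pad t m (m + 1) (by omega) k'
        (fun b hb => by simp [hk', hb]), zero_add,
        act_congr t m k' k (fun b hb => by simp [hk', hb])]
      exact pad hP m (by omega) k h2 a (by omega)
    · rcases Nat.lt_or_eq_of_le hb with h | rfl
      · obtain ⟨v, hv⟩ := h3 b (by omega)
        refine ⟨v, ?_⟩
        have := h1 b (by omega)
        rw [← hv]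
        simp only [Pi.sub_apply, hk', if_pos (show b ≤ m by omega)] at this ⊢
        rw [this]; abel
      · exact ⟨u, by simpa [hk'] using hu⟩

end

theorem mem_Dsub {q n : ℕ} (s : ℕ → Matrix (Fin q) (Fin q) ℂ) (x : Fin (n + 1) × Fin q → ℂ) :
    x ∈ Dsub q n s ↔ ∀ j : Fin (n + 1), ∃ u, (fun i => x (j, i)) = LS q s j.val *ᵥ u := by
  have key : ∀ (v : Fin (n + 1) × Fin q → ℂ) j i, (Ldiag q n s *ᵥ v) (j, i)
      = (LS q s j.val *ᵥ fun k => v (j, k)) i := by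
    intro v j i
    simp only [Matrix.mulVec, dotProduct, Ldiag, Matrix.of_apply, Fintype.sum_prod_type]
    rw [Finset.sum_eq_single j]
    · simp
    · intro b _ hb
      simp [Ne.symm hb]
    · simp
  constructor
  · rintro ⟨v, rfl⟩ j
    refine ⟨fun k => v (j, k), ?_⟩
    ext i
    exact key v j i
  · intro h
    choose u hu using h
    refine ⟨fun p => u p.1 p.2, ?_⟩
    ext ⟨j, i⟩
    have := congrFun (hu j) i
    rw [Matrix.mulVecLin_apply, key]
    exact this.symm

/-- The block diagonal range is the product of the ranges. -/
noncomputable def DsubEquiv {q n : ℕ} (s : ℕ → Matrix (Fin q) (Fin q) ℂ) :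
    Dsub q n s ≃ₗ[ℂ] ((j : Fin (n + 1)) → LinearMap.range (LS q s j.val).mulVecLin) where
  toFun x j := ⟨fun i => x.1 (j, i), by
    obtain ⟨u, hu⟩ := (mem_Dsub s x.1).1 x.2 j
    exact ⟨u, hu.symm⟩⟩
  invFun y := ⟨fun p => (y p.1).1 p.2, by
    rw [mem_Dsub]
    intro j
    obtain ⟨u, hu⟩ := (y j).2
    exact ⟨u, hu.symm⟩⟩
  map_add' _ _ := rfl
  map_smul' _ _ := rfl
  left_inv _ := rfl
  right_inv _ := rfl

theorem LS_congr {q : ℕ} (s t : ℕ → Matrix (Fin q) (Fin q) ℂ) (n : ℕ)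
    (h : ∀ j ≤ 2 * n, t j = s j) : LS q t n = LS q s n := by
  cases n with
  | zero => exact h 0 (by omega)
  | succ n =>
    have h1 : hank q n t = hank q n s := by
      ext i k
      have h1 := i.1.2
      have h2 := k.1.2
      simp only [hank, Matrix.of_apply]
      rw [h _ (by omega)]
    have h2 : ∀ j : Fin (n + 1) × Fin q, t (n + 1 + j.1.val) = s (n + 1 + j.1.val) := by
      intro j
      have := j.1.2
      exact h _ (by omega)
    simp only [LS, h1, h2, h _ le_rfl]

/-- Proposition (T1.24-1): for a Hankel nonnegative definite extendable sequence
`(s_j)_{j=0}^{2n}`, the canonical subspace `D_n` is a Dubovoj subspace corresponding to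
`(H_n, T_{q,n})`, with `dim D_n = rank H_n = Σ_{j=0}^n rank L_j`. -/
theorem canonical_dubovoj_subspace
    (q : ℕ) (hq : 1 ≤ q) (n : ℕ) (s : ℕ → Matrix (Fin q) (Fin q) ℂ)
    (hext : ∃ t : ℕ → Matrix (Fin q) (Fin q) ℂ,
      (∀ j ≤ 2 * n, t j = s j) ∧ (hank q (n + 1) t).PosSemidef) :
    Submodule.map (Matrix.mulVecLin (bshift q n)ᴴ) (Dsub q n s) ≤ Dsub q n s ∧
    LinearMap.ker (Matrix.mulVecLin (hank q n s)) ⊓ Dsub q n s = ⊥ ∧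
    LinearMap.ker (Matrix.mulVecLin (hank q n s)) ⊔ Dsub q n s = ⊤ ∧
    Module.finrank ℂ ↥(Dsub q n s) = (hank q n s).rank ∧
    Module.finrank ℂ ↥(Dsub q n s) = ∑ j ∈ Finset.range (n + 1), (LS q s j).rank := by
  obtain ⟨t, hts, hP⟩ := hext
  have hH : hank q n s = hank q n t := by
    ext i k
    have h1 := i.1.2
    have h2 := k.1.2
    simp only [hank, Matrix.of_apply]
    rw [hts _ (by omega)]
  have hLS : ∀ j ≤ n, LS q s j = LS q t j := fun j hj =>
    (LS_congr s t j (fun i hi => hts i (by omega))).symm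
  have hinf : LinearMap.ker (Matrix.mulVecLin (hank q n s)) ⊓ Dsub q n s = ⊥ := by
    rw [eq_bot_iff]
    rintro x ⟨hx1, hx2⟩
    have hk : hank q n s *ᵥ x = 0 := hx1
    rw [hH, hank_ker t x (ex x) (ex_spec x)] at hk
    have hx2 := (mem_Dsub s x).1 hx2
    have h0 := inter hP n (by omega) (ex x) hk (fun b hb => by
      obtain ⟨u, hu⟩ := hx2 ⟨b, by omega⟩
      refine ⟨u, ?_⟩
      rw [← hLS b hb, ← hu]
      ext i
      exact ex_spec x (⟨b, by omega⟩, i))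
    rw [Submodule.mem_bot]
    ext p
    rw [← ex_spec x p, h0 _ (by have := p.1.2; omega)]
    rfl
  have hsup : LinearMap.ker (Matrix.mulVecLin (hank q n s)) ⊔ Dsub q n s = ⊤ := by
    rw [eq_top_iff]
    rintro x -
    obtain ⟨k, d, h1, h2, h3⟩ := span hP n (by omega) (ex x)
    rw [Submodule.mem_sup]
    refine ⟨fun p => k p.1.val p.2, ?_, fun p => d p.1.val p.2, ?_, ?_⟩
    · rw [LinearMap.mem_ker, Matrix.mulVecLin_apply, hH, hank_ker t _ k (fun _ => rfl)]
      exact h2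
    · rw [mem_Dsub]
      intro j
      obtain ⟨u, hu⟩ := h3 j.val (by omega)
      refine ⟨u, ?_⟩
      rw [hLS _ (by omega)]
      exact hu
    · ext p
      rw [← ex_spec x p, h1 _ (by have := p.1.2; omega)]
      rfl
  refine ⟨?_, hinf, hsup, ?_, ?_⟩
  · rintro _ ⟨x, hx, rfl⟩
    have hx := (mem_Dsub s x).1 hx
    rw [mem_Dsub]
    intro j
    by_cases hj : j.val + 1 < n + 1
    · obtain ⟨u, hu⟩ := hx ⟨j.val + 1, hj⟩
      have e : (fun i => (Matrix.mulVecLin (bshift q n)ᴴ) x (j, i))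
          = fun i => x (⟨j.val + 1, hj⟩, i) := by
        ext i
        simp only [Matrix.mulVecLin_apply, Matrix.mulVec, dotProduct, bshift,
          Matrix.conjTranspose_apply, Matrix.of_apply]
        rw [Finset.sum_eq_single (⟨j.val + 1, hj⟩, i)]
        · simp
        · rintro ⟨b, k⟩ _ hb
          rw [if_neg]
          · simp
          · rintro ⟨h1, h2⟩
            exact hb (Prod.ext (Fin.ext h1) h2)
        · simp
      rw [e, hu]
      rw [hLS _ (show j.val ≤ n by omega)]
      rw [hLS _ (show j.val + 1 ≤ n by omega)]
      exact range_mono _ _ (LS_facts hP _ (by omega)).1 (LS_facts hP _ (by omega)).1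
        (LS_ker hP j.val (by omega)) u
    · refine ⟨0, ?_⟩
      rw [Matrix.mulVec_zero]
      ext i
      simp only [Matrix.mulVecLin_apply, Matrix.mulVec, dotProduct, bshift,
        Matrix.conjTranspose_apply, Matrix.of_apply]
      refine Finset.sum_eq_zero fun p _ => ?_
      rw [if_neg]
      · simp
      · rintro ⟨h1, -⟩
        have := p.1.2
        omega
  · have h1 := Submodule.finrank_sup_add_finrank_inf_eq
      (LinearMap.ker (Matrix.mulVecLin (hank q n s))) (Dsub q n s)
    rw [hinf, hsup, finrank_bot, finrank_top] at h1
    have h2 := LinearMap.finrank_range_add_finrank_ker (Matrix.mulVecLin (hank q n s))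
    unfold Matrix.rank
    omega
  · rw [(DsubEquiv s).finrank_eq, Module.finrank_pi_fintype, Finset.sum_range]
    rfl
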